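/- Let α₀ = (13√173 + 39)/82 = [2; 1,1,3,1,1,1,1,3, 1,1,3,1,1,1,1,3, …] (purely periodic from a₁ with period 1,1,3,1,1,1,1,3). Then for an irrational α equivalent neither to (1+√5)/2 nor to (1+√17)/2, one has 𝔨(α) = 𝔨(α₀) = 164/(13√173) if and only if α is equivalent to α₀. -/

import Mathlib

open Filter

/-- The tails `αₙ = [aₙ; aₙ₊₁, …]` of the continued fraction of `α`. -/
noncomputable def cfTail (α : ℝ) : ℕ → ℝ
  | 0 => α
  | n + 1 => (Int.fract (cfTail α n))⁻¹

/-- The partial quotients `aₙ` of the continued fraction of `α`. -/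
noncomputable def cfDigit (α : ℝ) (n : ℕ) : ℤ := ⌊cfTail α n⌋

/-- Value `[a; b, c, …]` of a finite continued fraction given by a list. -/
noncomputable def finCF : List ℤ → ℝ
  | [] => 0
  | a :: l => (a : ℝ) + (finCF l)⁻¹

/-- `α*ₙ = [0; aₙ, aₙ₋₁, …, a₁]`. -/
noncomputable def cfStar (α : ℝ) (n : ℕ) : ℝ :=
  (finCF (((List.range' 1 n).reverse).map (cfDigit α)))⁻¹

/-- Numerators `pₙ` of the convergents of `α`. -/
noncomputable def cfNum (α : ℝ) : ℕ → ℤ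
  | 0 => cfDigit α 0
  | 1 => cfDigit α 1 * cfDigit α 0 + 1
  | n + 2 => cfDigit α (n + 2) * cfNum α (n + 1) + cfNum α n

/-- Denominators `qₙ` of the convergents of `α`. -/
noncomputable def cfDen (α : ℝ) : ℕ → ℤ
  | 0 => 1
  | 1 => cfDigit α 1
  | n + 2 => cfDigit α (n + 2) * cfDen α (n + 1) + cfDen α n

/-- The irrationality measure function `ψ_α^[2]` for "second best" approximations. -/
noncomputable def psi2 (α : ℝ) (t : ℝ) : ℝ :=
  sInf { x : ℝ | ∃ p q : ℤ, 1 ≤ q ∧ (q : ℝ) ≤ t ∧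
    (∀ n : ℕ, (p, q) ≠ (cfNum α n, cfDen α n)) ∧ x = |(q : ℝ) * α - (p : ℝ)| }

/-- The Diophantine constant `𝔨(α) = liminf_{t → ∞} t · ψ_α^[2](t)`. -/
noncomputable def kConst (α : ℝ) : ℝ := liminf (fun t : ℝ => t * psi2 α t) atTop

/-- Two numbers are equivalent if the tails of their continued fraction expansions
coincide: `a_{n+k} = b_{m+k}` for all `k ≥ 1`, for some positive integers `m`, `n`. -/
def CFEquiv (α β : ℝ) : Prop :=
  ∃ n m : ℕ, 0 < n ∧ 0 < m ∧ ∀ k : ℕ, 0 < k → cfDigit α (n + k) = cfDigit β (m + k)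

/-- The spectrum `𝕃₂` of values of `𝔨`. -/
def L2 : Set ℝ := { l : ℝ | ∃ α : ℝ, Irrational α ∧ l = kConst α }

/-- `κ¹ₙ(α) = (1 + α*ₙ₋₁)(αₙ − 1)/(αₙ + α*ₙ₋₁)`. -/
noncomputable def kappa1 (α : ℝ) (n : ℕ) : ℝ :=
  (1 + cfStar α (n - 1)) * (cfTail α n - 1) / (cfTail α n + cfStar α (n - 1))

/-- `κ²ₙ(α) = (1 − α*ₙ)(αₙ₊₁ + 1)/(αₙ₊₁ + α*ₙ)`. -/
noncomputable def kappa2 (α : ℝ) (n : ℕ) : ℝ :=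
  (1 - cfStar α n) * (cfTail α (n + 1) + 1) / (cfTail α (n + 1) + cfStar α n)

/-- `κ⁴ₙ(α) = 4/(αₙ + α*ₙ₋₁)`. -/
noncomputable def kappa4 (α : ℝ) (n : ℕ) : ℝ :=
  4 / (cfTail α n + cfStar α (n - 1))

theorem irrational_cfTail {α : ℝ} (hα : Irrational α) (n : ℕ) : Irrational (cfTail α n) := by
  induction n with
  | zero => exact hα
  | succ n ih =>
    have h : Irrational (Int.fract (cfTail α n)) := ih.sub_intCast _
    exact h.inv

theorem fract_cfTail_pos {α : ℝ} (hα : Irrational α) (n : ℕ) : 0 < Int.fract (cfTail α n) := by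
  refine lt_of_le_of_ne (Int.fract_nonneg _) fun h => ?_
  have h' : Irrational (Int.fract (cfTail α n)) := (irrational_cfTail hα n).sub_intCast _
  exact h'.ne_zero h.symm

theorem one_lt_cfTail_succ {α : ℝ} (hα : Irrational α) (n : ℕ) : 1 < cfTail α (n + 1) :=
  (one_lt_inv₀ (fract_cfTail_pos hα n)).2 (Int.fract_lt_one _)

theorem cfTail_eq (α : ℝ) (n : ℕ) : cfTail α n = cfDigit α n + (cfTail α (n + 1))⁻¹ := by
  simp [cfTail, cfDigit]

theorem one_le_cfDigit_succ {α : ℝ} (hα : Irrational α) (n : ℕ) : 1 ≤ cfDigit α (n + 1) :=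
  Int.le_floor.2 (by simpa using (one_lt_cfTail_succ hα n).le)

theorem cfDen_pos {α : ℝ} (hα : Irrational α) (n : ℕ) : 0 < cfDen α n := by
  induction n using Nat.twoStepInduction with
  | zero => simp [cfDen]
  | one => have := one_le_cfDigit_succ hα 0; rw [cfDen]; exact this
  | more n h0 h1 =>
    have := one_le_cfDigit_succ hα (n + 1)
    simp only [cfDen]
    nlinarith

theorem cfDen_lt_succ {α : ℝ} (hα : Irrational α) (n : ℕ) :
    cfDen α (n + 1) < cfDen α (n + 2) := by
  have h := one_le_cfDigit_succ hα (n + 1)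
  have h0 := cfDen_pos hα n
  have h1 := cfDen_pos hα (n + 1)
  rw [cfDen]
  nlinarith

theorem cfDen_le_succ {α : ℝ} (hα : Irrational α) (n : ℕ) : cfDen α n ≤ cfDen α (n + 1) := by
  cases n with
  | zero => have := cfDen_pos hα 1; simp only [cfDen] at *; omega
  | succ n => exact (cfDen_lt_succ hα n).le

theorem monotone_cfDen {α : ℝ} (hα : Irrational α) : Monotone (cfDen α) :=
  monotone_nat_of_le_succ (cfDen_le_succ hα)

theorem le_cfDen {α : ℝ} (hα : Irrational α) (n : ℕ) : (n : ℤ) ≤ cfDen α n := by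
  induction n with
  | zero => simp [cfDen]
  | succ n ih =>
    cases n with
    | zero => have := cfDen_pos hα 1; simp at *; omega
    | succ n =>
      have h : cfDen α (n + 1) < cfDen α (n + 1 + 1) := cfDen_lt_succ hα n
      push_cast at *
      omega

theorem cfNum_mul_cfDen_sub (α : ℝ) (n : ℕ) :
    cfNum α (n + 1) * cfDen α n - cfNum α n * cfDen α (n + 1) = (-1) ^ n := by
  induction n with
  | zero => simp [cfNum, cfDen]; ring
  | succ n ih => rw [cfNum, cfDen, pow_succ, ← ih]; ring

/-- The signed error `qₙ α - pₙ` of the `n`-th convergent. -/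
noncomputable def cfErr (α : ℝ) (n : ℕ) : ℝ := cfDen α n * α - cfNum α n

theorem cfErr_eq {α : ℝ} (hα : Irrational α) (n : ℕ) :
    cfErr α n = -(cfTail α (n + 2) * cfErr α (n + 1)) := by
  induction n with
  | zero =>
    have h1 := one_lt_cfTail_succ hα 0
    have h2 := one_lt_cfTail_succ hα 1
    have e0 := cfTail_eq α 0
    have e1 := cfTail_eq α 1
    have e : cfTail α 0 = α := rfl
    simp only [zero_add, Nat.reduceAdd, e] at *
    have h0 : cfTail α 1 ≠ 0 := by positivity
    have h0' : cfTail α 2 ≠ 0 := by positivity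
    have e0' : cfTail α 1 * (α - cfDigit α 0) = 1 := by
      rw [sub_eq_of_eq_add' e0]; exact mul_inv_cancel₀ h0
    have e1' : cfTail α 2 * (cfTail α 1 - cfDigit α 1) = 1 := by
      rw [sub_eq_of_eq_add' e1]; exact mul_inv_cancel₀ h0'
    simp only [cfErr, cfNum, cfDen]
    push_cast
    linear_combination (-(α - cfDigit α 0)) * e1' + cfTail α 2 * e0'
  | succ n ih =>
    have h2 := one_lt_cfTail_succ hα (n + 2)
    have e1 := cfTail_eq α (n + 2)
    have h0' : cfTail α (n + 3) ≠ 0 := by positivity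
    have e2 : cfTail α (n + 3) * (cfTail α (n + 2) - cfDigit α (n + 2)) = 1 := by
      rw [e1]; field_simp; ring
    have e : cfErr α (n + 2) = cfDigit α (n + 2) * cfErr α (n + 1) + cfErr α n := by
      simp only [cfErr, cfNum, cfDen]; push_cast; ring
    rw [show n + 1 + 1 = n + 2 from rfl, e, ih]
    linear_combination (-cfErr α (n + 1)) * e2

/-- The ratio `qₙ / qₙ₊₁` of consecutive denominators. -/
noncomputable def denRatio (α : ℝ) (n : ℕ) : ℝ := cfDen α n / cfDen α (n + 1)

theorem denRatio_pos {α : ℝ} (hα : Irrational α) (n : ℕ) : 0 < denRatio α n := by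
  have h0 : (0 : ℝ) < cfDen α n := by exact_mod_cast cfDen_pos hα n
  have h1 : (0 : ℝ) < cfDen α (n + 1) := by exact_mod_cast cfDen_pos hα (n + 1)
  exact div_pos h0 h1

theorem denRatio_succ {α : ℝ} (hα : Irrational α) (n : ℕ) :
    denRatio α (n + 1) = (cfDigit α (n + 2) + denRatio α n)⁻¹ := by
  have h0 : (0 : ℝ) < cfDen α n := by exact_mod_cast cfDen_pos hα n
  have h1 : (0 : ℝ) < cfDen α (n + 1) := by exact_mod_cast cfDen_pos hα (n + 1)
  simp only [denRatio, cfDen]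
  push_cast
  field_simp

theorem denRatio_succ_lt_one {α : ℝ} (hα : Irrational α) (n : ℕ) : denRatio α (n + 1) < 1 := by
  have h1 : (0 : ℝ) < cfDen α (n + 2) := by exact_mod_cast cfDen_pos hα (n + 2)
  rw [denRatio, div_lt_one h1]
  exact_mod_cast cfDen_lt_succ hα n

/-- The fractional continuation `[0; aₙ₊₃, aₙ₊₄, …]` following the digit `aₙ₊₂`. -/
noncomputable def cfFront (α : ℝ) (n : ℕ) : ℝ := (cfTail α (n + 3))⁻¹

theorem cfFront_pos {α : ℝ} (hα : Irrational α) (n : ℕ) : 0 < cfFront α n :=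
  inv_pos.2 (zero_lt_one.trans (one_lt_cfTail_succ hα (n + 2)))

theorem cfFront_lt_one {α : ℝ} (hα : Irrational α) (n : ℕ) : cfFront α n < 1 :=
  inv_lt_one_of_one_lt₀ (one_lt_cfTail_succ hα (n + 2))

theorem cfTail_eq_add_cfFront (α : ℝ) (n : ℕ) :
    cfTail α (n + 2) = cfDigit α (n + 2) + cfFront α n := cfTail_eq α (n + 2)

theorem cfFront_eq (α : ℝ) (n : ℕ) :
    cfFront α n = (cfDigit α (n + 3) + cfFront α (n + 1))⁻¹ := by
  rw [cfFront, cfTail_eq_add_cfFront]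

theorem cfDen_mul_abs_cfErr {α : ℝ} (hα : Irrational α) (n : ℕ) :
    cfDen α (n + 1) * |cfErr α (n + 1)| * (cfDigit α (n + 2) + denRatio α n + cfFront α n) = 1 := by
  have h1 : (0 : ℝ) < cfDen α (n + 1) := by exact_mod_cast cfDen_pos hα (n + 1)
  have hd : (cfNum α (n + 1) * cfDen α n - cfNum α n * cfDen α (n + 1) : ℝ) = (-1) ^ n := by
    exact_mod_cast cfNum_mul_cfDen_sub α n
  have hr : denRatio α n * cfDen α (n + 1) = cfDen α n := by
    rw [denRatio]; field_simp
  have e := cfErr_eq hα n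
  have hT := cfTail_eq_add_cfFront α n
  have hpos : 0 < cfTail α (n + 2) + denRatio α n := by
    have := one_lt_cfTail_succ hα (n + 1)
    have := denRatio_pos hα n
    positivity
  have key : cfDen α (n + 1) * (cfTail α (n + 2) + denRatio α n) * cfErr α (n + 1)
      = -(-1) ^ n := by
    rw [← hd]
    have e' : cfDen α (n + 1) * cfErr α n - cfDen α n * cfErr α (n + 1) =
        (cfNum α (n + 1) * cfDen α n - cfNum α n * cfDen α (n + 1) : ℝ) := by
      simp only [cfErr]; ring
    rw [← e', e]
    linear_combination cfErr α (n + 1) * hr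
  have key' := congrArg abs key
  rw [abs_mul, abs_of_pos (mul_pos h1 hpos), abs_neg, abs_pow, abs_neg, abs_one, one_pow] at key'
  rw [hT] at key'
  linear_combination key'

theorem mul_abs_combination {α : ℝ} (hα : Irrational α) (n : ℕ) (x y : ℝ) :
    (x * cfDen α (n + 2) + y * cfDen α (n + 1)) * |x * cfErr α (n + 2) + y * cfErr α (n + 1)| =
      (x * (cfDigit α (n + 2) + denRatio α n) + y) * |x * cfFront α n - y| /
        (cfDigit α (n + 2) + denRatio α n + cfFront α n) := by
  have h1 : (0 : ℝ) < cfDen α (n + 1) := by exact_mod_cast cfDen_pos hα (n + 1)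
  have hY := cfFront_pos hα n
  have hX := denRatio_pos hα n
  have ha : (1 : ℝ) ≤ cfDigit α (n + 2) := by exact_mod_cast one_le_cfDigit_succ hα (n + 1)
  have hs : 0 < cfDigit α (n + 2) + denRatio α n + cfFront α n := by positivity
  have hq : (cfDen α (n + 2) : ℝ) = (cfDigit α (n + 2) + denRatio α n) * cfDen α (n + 1) := by
    rw [cfDen, denRatio]; push_cast; field_simp
  have he : cfErr α (n + 2) = -(cfFront α n * cfErr α (n + 1)) := by
    have h3 := one_lt_cfTail_succ hα (n + 2)
    rw [cfErr_eq hα (n + 1), cfFront]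
    field_simp
  have hm := cfDen_mul_abs_cfErr hα n
  rw [eq_div_iff hs.ne', hq, he,
    show x * -(cfFront α n * cfErr α (n + 1)) + y * cfErr α (n + 1) =
      -((x * cfFront α n - y) * cfErr α (n + 1)) by ring, abs_neg, abs_mul]
  linear_combination ((x * (cfDigit α (n + 2) + denRatio α n) + y) * |x * cfFront α n - y|) * hm

/-- `(p, q)` is not a pair numerator/denominator of a convergent of `α`. -/
def NotConvergent (α : ℝ) (p q : ℤ) : Prop := ∀ n : ℕ, (p, q) ≠ (cfNum α n, cfDen α n)

theorem notConvergent_two_mul (α : ℝ) (n : ℕ) :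
    NotConvergent α (2 * cfNum α n) (2 * cfDen α n) := by
  intro m h
  have hd := cfNum_mul_cfDen_sub α m
  simp only [Prod.mk.injEq] at h
  rw [← h.1, ← h.2] at hd
  have : (2 : ℤ) ∣ (-1) ^ m :=
    ⟨cfNum α (m + 1) * cfDen α n - cfNum α n * cfDen α (m + 1), by rw [← hd]; ring⟩
  have h2 := this.trans (pow_dvd_pow_of_dvd (neg_dvd.2 (dvd_refl (1 : ℤ))) m)
  rw [one_pow] at h2
  omega

theorem notConvergent_of_lt {α : ℝ} (hα : Irrational α) {p q : ℤ} {n : ℕ}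
    (h1 : cfDen α n < q) (h2 : q < cfDen α (n + 1)) : NotConvergent α p q := by
  intro m h
  simp only [Prod.mk.injEq] at h
  rw [h.2] at h1 h2
  have hm := monotone_cfDen hα
  have := hm.reflect_lt h1
  have := hm.reflect_lt h2
  omega

theorem psi2_set_bddBelow (α t : ℝ) : BddBelow { x : ℝ | ∃ p q : ℤ, 1 ≤ q ∧ (q : ℝ) ≤ t ∧
    (∀ n : ℕ, (p, q) ≠ (cfNum α n, cfDen α n)) ∧ x = |(q : ℝ) * α - (p : ℝ)| } :=
  ⟨0, by rintro _ ⟨p, q, -, -, -, rfl⟩; exact abs_nonneg _⟩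

theorem psi2_nonneg (α t : ℝ) : 0 ≤ psi2 α t :=
  Real.sInf_nonneg (by rintro _ ⟨p, q, -, -, -, rfl⟩; exact abs_nonneg _)

theorem psi2_le {α : ℝ} {p q : ℤ} (hq : 1 ≤ q) (h : NotConvergent α p q) :
    psi2 α q ≤ |(q : ℝ) * α - p| :=
  csInf_le (psi2_set_bddBelow α q) ⟨p, q, hq, le_rfl, h, rfl⟩

theorem isBoundedUnder_mul_psi2 (α : ℝ) :
    IsBoundedUnder (· ≥ ·) atTop (fun t : ℝ => t * psi2 α t) :=
  isBoundedUnder_of_eventually_ge (a := 0)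
    ((eventually_ge_atTop 0).mono fun t ht => mul_nonneg ht (psi2_nonneg α t))

theorem two_mul_cfDen_mul_psi2_le {α : ℝ} (hα : Irrational α) (n : ℕ) :
    (2 * cfDen α (n + 1) : ℝ) * psi2 α (2 * cfDen α (n + 1) : ℝ) ≤ 4 := by
  have hq := cfDen_pos hα (n + 1)
  have h1 : (0 : ℝ) < cfDen α (n + 1) := by exact_mod_cast hq
  have h := psi2_le (by omega) (notConvergent_two_mul α (n + 1))
  push_cast at h
  have hm := cfDen_mul_abs_cfErr hα n
  have hY := cfFront_pos hα n
  have hX := denRatio_pos hα n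
  have ha : (1 : ℝ) ≤ cfDigit α (n + 2) := by exact_mod_cast one_le_cfDigit_succ hα (n + 1)
  have e : |2 * (cfDen α (n + 1) : ℝ) * α - 2 * cfNum α (n + 1)| = 2 * |cfErr α (n + 1)| := by
    rw [← abs_two (α := ℝ), ← abs_mul, cfErr, abs_two]; congr 1; ring
  rw [e] at h
  have h3 : cfDen α (n + 1) * |cfErr α (n + 1)| ≤ 1 := by
    have : 0 ≤ cfDen α (n + 1) * |cfErr α (n + 1)| := by positivity
    nlinarith
  nlinarith

theorem isCoboundedUnder_mul_psi2 {α : ℝ} (hα : Irrational α) :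
    IsCoboundedUnder (· ≥ ·) atTop (fun t : ℝ => t * psi2 α t) := by
  refine IsCoboundedUnder.of_frequently_le (a := 4) (frequently_atTop.2 fun b => ?_)
  obtain ⟨n, hn⟩ := exists_nat_ge b
  refine ⟨2 * cfDen α (n + 1), ?_, two_mul_cfDen_mul_psi2_le hα n⟩
  have h : ((n + 1 : ℕ) : ℝ) ≤ cfDen α (n + 1) := by exact_mod_cast le_cfDen hα (n + 1)
  have : (0 : ℝ) ≤ n := n.cast_nonneg
  push_cast at h
  linarith

theorem le_of_lt_kConst {α c : ℝ} (hc : c < kConst α) :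
    ∃ N : ℤ, ∀ p q : ℤ, N ≤ q → NotConvergent α p q → c ≤ q * |(q : ℝ) * α - p| := by
  have h := eventually_lt_of_lt_liminf hc (isBoundedUnder_mul_psi2 α)
  obtain ⟨t, ht⟩ := eventually_atTop.1 h
  refine ⟨max 1 ⌈t⌉, fun p q hq hpq => ?_⟩
  have h1 : 1 ≤ q := (le_max_left _ _).trans hq
  have h2 : t ≤ q := (Int.le_ceil t).trans (by exact_mod_cast (le_max_right _ _).trans hq)
  have hq0 : (0 : ℝ) ≤ q := by exact_mod_cast (by omega : 0 ≤ q)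
  exact (ht q h2).le.trans (mul_le_mul_of_nonneg_left (psi2_le h1 hpq) hq0)

theorem exists_pos_le_abs_mul_sub {α : ℝ} (hα : Irrational α) (N : ℕ) :
    ∃ δ : ℝ, 0 < δ ∧ ∀ p q : ℤ, 1 ≤ q → q ≤ N → δ ≤ |(q : ℝ) * α - p| := by
  induction N with
  | zero => exact ⟨1, one_pos, fun p q h1 h2 => by norm_num at h2; omega⟩
  | succ N ih =>
    obtain ⟨δ, hδ, h⟩ := ih
    have hirr : Irrational (((N + 1 : ℕ) : ℝ) * α) := hα.natCast_mul (by omega)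
    have hpos : 0 < |((N + 1 : ℕ) : ℝ) * α - round (((N + 1 : ℕ) : ℝ) * α)| :=
      abs_pos.2 (hirr.sub_intCast _).ne_zero
    refine ⟨min δ _, lt_min hδ hpos, fun p q h1 h2 => ?_⟩
    rcases eq_or_ne q ((N + 1 : ℕ) : ℤ) with rfl | hne
    · exact (min_le_right _ _).trans (round_le _ p)
    · exact (min_le_left _ _).trans (h p q h1 (by omega))

theorem le_kConst {α c : ℝ} (hα : Irrational α) (N : ℕ)
    (h : ∀ p q : ℤ, N ≤ q → NotConvergent α p q → c ≤ q * |(q : ℝ) * α - p|) :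
    c ≤ kConst α := by
  obtain ⟨δ, hδ, hN⟩ := exists_pos_le_abs_mul_sub hα N
  refine le_liminf_of_le (isCoboundedUnder_mul_psi2 hα) ?_
  filter_upwards [eventually_ge_atTop 2, eventually_ge_atTop (c / δ)] with t ht2 htc
  have ht : 0 < t := by linarith
  rw [← div_le_iff₀' ht]
  refine le_csInf ⟨_, 2 * cfNum α 0, 2 * cfDen α 0, by simp [cfDen], by simpa [cfDen] using ht2,
    notConvergent_two_mul α 0, rfl⟩ ?_
  rintro _ ⟨p, q, h1, hqt, hpq, rfl⟩
  rw [div_le_iff₀' ht]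
  rcases le_total (N : ℤ) q with hNq | hNq
  · exact (h p q hNq hpq).trans (mul_le_mul_of_nonneg_right hqt (abs_nonneg _))
  · rw [div_le_iff₀ hδ] at htc
    exact htc.trans (mul_le_mul_of_nonneg_left (hN p q h1 hNq) ht.le)

theorem inv_add_le {d z c : ℝ} (h : 0 < d + z) (hc : 1 ≤ c * (d + z)) : (d + z)⁻¹ ≤ c := by
  rw [inv_eq_one_div, div_le_iff₀ h]; exact hc

theorem le_inv_add {d z c : ℝ} (h : 0 < d + z) (hc : c * (d + z) ≤ 1) : c ≤ (d + z)⁻¹ := by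
  rw [inv_eq_one_div, le_div_iff₀ h]; exact hc

/-- A sequence of digits `b` with its backward and forward continuations `X`, `Y`, all of whose
second best approximation constants are at least `0.9591`. -/
structure Admissible (b : ℕ → ℤ) (X Y : ℕ → ℝ) : Prop where
  one_le : ∀ n, 1 ≤ b n
  X_pos : ∀ n, 0 < X n
  X_lt : ∀ n, X n < 1
  Y_pos : ∀ n, 0 < Y n
  Y_lt : ∀ n, Y n < 1
  X_succ : ∀ n, X (n + 1) = (b n + X n)⁻¹
  Y_eq : ∀ n, Y n = (b (n + 1) + Y (n + 1))⁻¹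
  bound : ∀ n, 0.9591 * (b n + X n + Y n) ≤ 4
  bound_left : ∀ n, 2 ≤ b n → 0.9591 * (b n + X n + Y n) ≤ (1 + X n) * (b n - 1 + Y n)
  bound_right : ∀ n, 2 ≤ b n → 0.9591 * (b n + X n + Y n) ≤ (b n - 1 + X n) * (1 + Y n)

namespace Admissible

variable {b : ℕ → ℤ} {X Y : ℕ → ℝ}

theorem le_four (h : Admissible b X Y) (n : ℕ) : b n ≤ 4 := by
  have h1 := h.bound n
  have h2 := h.X_pos n
  have h3 := h.Y_pos n
  have : (b n : ℝ) < 5 := by linarith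
  have : b n < 5 := by exact_mod_cast this
  omega

theorem X_eq_one (h : Admissible b X Y) {n : ℕ} (hb : b n = 1) : X (n + 1) = (1 + X n)⁻¹ := by
  rw [h.X_succ, hb]; norm_num

theorem X_eq_three (h : Admissible b X Y) {n : ℕ} (hb : b n = 3) : X (n + 1) = (3 + X n)⁻¹ := by
  rw [h.X_succ, hb]; norm_num

theorem Y_eq_one (h : Admissible b X Y) {n : ℕ} (hb : b (n + 1) = 1) :
    Y n = (1 + Y (n + 1))⁻¹ := by
  rw [h.Y_eq, hb]; norm_num

theorem Y_eq_three (h : Admissible b X Y) {n : ℕ} (hb : b (n + 1) = 3) :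
    Y n = (3 + Y (n + 1))⁻¹ := by
  rw [h.Y_eq, hb]; norm_num

theorem fifth_le_X (h : Admissible b X Y) (n : ℕ) : 1 / 5 ≤ X (n + 1) := by
  have h1 : (b n : ℝ) ≤ 4 := by exact_mod_cast h.le_four n
  have h1' : (1 : ℝ) ≤ b n := by exact_mod_cast h.one_le n
  have h2 := h.X_lt n
  have h3 := h.X_pos n
  rw [h.X_succ]
  exact le_inv_add (by linarith) (by linarith)

theorem fifth_le_Y (h : Admissible b X Y) (n : ℕ) : 1 / 5 ≤ Y n := by
  have h1 : (b (n + 1) : ℝ) ≤ 4 := by exact_mod_cast h.le_four (n + 1)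
  have h1' : (1 : ℝ) ≤ b (n + 1) := by exact_mod_cast h.one_le (n + 1)
  have h2 := h.Y_lt (n + 1)
  have h3 := h.Y_pos (n + 1)
  rw [h.Y_eq]
  exact le_inv_add (by linarith) (by linarith)

theorem X_le_five_sixths (h : Admissible b X Y) (n : ℕ) : X (n + 2) ≤ 5 / 6 := by
  have h1' : (1 : ℝ) ≤ b (n + 1) := by exact_mod_cast h.one_le (n + 1)
  have h2 := h.fifth_le_X n
  rw [h.X_succ]
  exact inv_add_le (by linarith) (by linarith)

theorem Y_le_five_sixths (h : Admissible b X Y) (n : ℕ) : Y n ≤ 5 / 6 := by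
  have h1' : (1 : ℝ) ≤ b (n + 1) := by exact_mod_cast h.one_le (n + 1)
  have h2 := h.fifth_le_Y (n + 1)
  rw [h.Y_eq]
  exact inv_add_le (by linarith) (by linarith)

theorem digit (h : Admissible b X Y) (n : ℕ) : b (n + 2) = 1 ∨ b (n + 2) = 3 := by
  have h1 := h.le_four (n + 2)
  have h2 := h.one_le (n + 2)
  have hX := h.X_le_five_sixths n
  have hX' := h.fifth_le_X (n + 1)
  have hY := h.Y_le_five_sixths (n + 2)
  have hY' := h.fifth_le_Y (n + 2)
  have h4 : b (n + 2) ≠ 4 := by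
    intro e
    have hb := h.bound (n + 2)
    rw [e] at hb
    norm_num at *
    linarith
  have h3 : b (n + 2) ≠ 2 := by
    intro e
    have hb := h.bound_left (n + 2) (by omega)
    rw [e] at hb
    norm_num at *
    nlinarith
  omega

theorem X_ge (h : Admissible b X Y) (n : ℕ) : 1 / 4 ≤ X (n + 3) := by
  have h2 := h.X_pos (n + 2)
  have h3 := h.X_lt (n + 2)
  rcases h.digit n with e | e
  · rw [h.X_eq_one e]; exact le_inv_add (by linarith) (by linarith)
  · rw [h.X_eq_three e]; exact le_inv_add (by linarith) (by linarith)

theorem Y_ge (h : Admissible b X Y) (n : ℕ) : 1 / 4 ≤ Y (n + 1) := by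
  have h2 := h.Y_pos (n + 2)
  have h3 := h.Y_lt (n + 2)
  rcases h.digit n with e | e
  · rw [h.Y_eq_one e]; exact le_inv_add (by linarith) (by linarith)
  · rw [h.Y_eq_three e]; exact le_inv_add (by linarith) (by linarith)

theorem X_le (h : Admissible b X Y) (n : ℕ) : X (n + 4) ≤ 4 / 5 := by
  have h2 := h.X_ge n
  rcases h.digit (n + 1) with e | e
  · rw [h.X_eq_one e]; exact inv_add_le (by linarith) (by linarith)
  · rw [h.X_eq_three e]; exact inv_add_le (by linarith) (by linarith)

theorem Y_le (h : Admissible b X Y) (n : ℕ) : Y (n + 1) ≤ 4 / 5 := by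
  have h2 := h.Y_ge (n + 1)
  rcases h.digit n with e | e
  · rw [h.Y_eq_one e]; exact inv_add_le (by linarith) (by linarith)
  · rw [h.Y_eq_three e]; exact inv_add_le (by linarith) (by linarith)

theorem bounds_three (h : Admissible b X Y) {n : ℕ} (hb : b n = 3) :
    X n + Y n ≤ 1.17058 ∧ 0.9591 * (3 + X n + Y n) ≤ (1 + X n) * (2 + Y n) ∧
      0.9591 * (3 + X n + Y n) ≤ (2 + X n) * (1 + Y n) := by
  have h1 := h.bound n
  have h2 := h.bound_left n (by omega)
  have h3 := h.bound_right n (by omega)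
  rw [hb] at h1 h2 h3
  push_cast at h1 h2 h3
  refine ⟨by linarith, ?_, ?_⟩ <;> linarith

theorem right_of_three (h : Admissible b X Y) {n : ℕ} (hb : b (n + 4) = 3) :
    b (n + 5) = 1 ∧ b (n + 6) = 1 := by
  obtain ⟨h1, h2, h3⟩ := h.bounds_three hb
  have hX := h.X_le n
  have hX' := h.X_ge (n + 1)
  have hY := h.Y_le (n + 4)
  have hY' := h.Y_ge (n + 4)
  have hY2 := h.Y_le (n + 5)
  have hY2' := h.Y_ge (n + 5)
  norm_num at *
  have e5 : b (n + 5) = 1 := by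
    refine (h.digit (n + 3)).resolve_right fun e => ?_
    have : Y (n + 4) ≤ 1 / 3 := by
      rw [h.Y_eq_three e]; exact inv_add_le (by linarith) (by linarith)
    nlinarith
  refine ⟨e5, (h.digit (n + 4)).resolve_right fun e => ?_⟩
  have : Y (n + 5) ≤ 1 / 3 := by
    rw [h.Y_eq_three e]; exact inv_add_le (by linarith) (by linarith)
  have : 3 / 4 ≤ Y (n + 4) := by
    rw [h.Y_eq_one e5]; exact le_inv_add (by linarith) (by linarith)
  nlinarith

theorem left_of_three (h : Admissible b X Y) {n : ℕ} (hb : b (n + 4) = 3) :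
    b (n + 3) = 1 ∧ b (n + 2) = 1 := by
  obtain ⟨h1, h2, h3⟩ := h.bounds_three hb
  have hX := h.X_le n
  have hX' := h.X_ge (n + 1)
  have hX3 := h.X_ge n
  have hX2 := h.X_pos (n + 2)
  have hY := h.Y_le (n + 3)
  have hY' := h.Y_ge (n + 3)
  norm_num at *
  have e5 : b (n + 3) = 1 := by
    refine (h.digit (n + 1)).resolve_right fun e => ?_
    have : X (n + 4) ≤ 1 / 3 := by
      rw [h.X_eq_three e]; exact inv_add_le (by linarith) (by linarith)
    nlinarith
  refine ⟨e5, (h.digit n).resolve_right fun e => ?_⟩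
  have : X (n + 3) ≤ 1 / 3 := by
    rw [h.X_eq_three e]; exact inv_add_le (by linarith) (by linarith)
  have : 3 / 4 ≤ X (n + 4) := by
    rw [h.X_eq_one e5]; exact le_inv_add (by linarith) (by linarith)
  nlinarith

theorem X_le_of_three (h : Admissible b X Y) {n : ℕ} (hb : b (n + 6) = 3) :
    X (n + 6) ≤ 0.65 := by
  obtain ⟨e1, e2⟩ := h.left_of_three hb
  have h1 := h.X_le n
  have h1' := h.X_pos (n + 4)
  have h2 : 0.55 ≤ X (n + 5) := by
    rw [h.X_eq_one e2]; exact le_inv_add (by linarith) (by linarith)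
  rw [h.X_eq_one e1]; exact inv_add_le (by linarith) (by linarith)

theorem Y_le_of_three (h : Admissible b X Y) {n : ℕ} (hb : b (n + 4) = 3) :
    Y (n + 4) ≤ 0.65 := by
  obtain ⟨e1, e2⟩ := h.right_of_three hb
  have h1 := h.Y_le (n + 5)
  have h1' := h.Y_pos (n + 6)
  have h2 : 0.55 ≤ Y (n + 5) := by
    rw [h.Y_eq_one e2]; exact le_inv_add (by linarith) (by linarith)
  rw [h.Y_eq_one e1]; exact inv_add_le (by linarith) (by linarith)

theorem X_ge' (h : Admissible b X Y) (n : ℕ) : 1 / 3.65 ≤ X (n + 7) := by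
  have h2 := h.X_pos (n + 6)
  rcases h.digit (n + 4) with e | e
  · have h3 := h.X_le (n + 2)
    rw [h.X_eq_one e]; exact le_inv_add (by linarith) (by linarith)
  · have h3 := h.X_le_of_three e
    rw [h.X_eq_three e]; exact le_inv_add (by linarith) (by linarith)

theorem Y_ge' (h : Admissible b X Y) (n : ℕ) : 1 / 3.65 ≤ Y (n + 3) := by
  have h2 := h.Y_pos (n + 4)
  rcases h.digit (n + 2) with e | e
  · have h3 := h.Y_le (n + 3)
    rw [h.Y_eq_one e]; exact le_inv_add (by linarith) (by linarith)
  · have h3 := h.Y_le_of_three e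
    rw [h.Y_eq_three e]; exact le_inv_add (by linarith) (by linarith)

theorem X_le' (h : Admissible b X Y) (n : ℕ) : X (n + 8) ≤ 3.65 / 4.65 := by
  have h2 := h.X_ge' n
  rcases h.digit (n + 5) with e | e
  · rw [h.X_eq_one e]; exact inv_add_le (by linarith) (by linarith)
  · rw [h.X_eq_three e]; exact inv_add_le (by linarith) (by linarith)

theorem Y_le' (h : Admissible b X Y) (n : ℕ) : Y (n + 3) ≤ 3.65 / 4.65 := by
  have h2 := h.Y_ge' (n + 1)
  rcases h.digit (n + 2) with e | e
  · rw [h.Y_eq_one e]; exact inv_add_le (by linarith) (by linarith)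
  · rw [h.Y_eq_three e]; exact inv_add_le (by linarith) (by linarith)

theorem long_block (h : Admissible b X Y) {n : ℕ} (hb : b (n + 9) = 3) (hb' : b (n + 12) = 1) :
    b (n + 13) = 1 ∧ b (n + 14) = 3 := by
  obtain ⟨h1, -, -⟩ := h.bounds_three hb
  obtain ⟨l1, l2⟩ := h.left_of_three hb
  obtain ⟨r1, r2⟩ := h.right_of_three hb
  have u := h.X_ge' n
  have x1 : X (n + 8) ≤ 0.78495 := by
    rw [h.X_eq_one l2]; exact inv_add_le (by linarith) (by linarith)
  have x1' := h.X_pos (n + 8)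
  have x : 0.56 ≤ X (n + 9) := by
    rw [h.X_eq_one l1]; exact le_inv_add (by linarith) (by linarith)
  have y0 : Y (n + 9) = (1 + Y (n + 10))⁻¹ := h.Y_eq_one r1
  have y1 : Y (n + 10) = (1 + Y (n + 11))⁻¹ := h.Y_eq_one r2
  have y2 : Y (n + 11) = (1 + Y (n + 12))⁻¹ := h.Y_eq_one hb'
  have p10 := h.Y_pos (n + 10)
  have p12 := h.Y_pos (n + 12)
  have p13 := h.Y_ge' (n + 10)
  have p14 := h.Y_pos (n + 14)
  have q14 := h.Y_le' (n + 11)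
  norm_num at p13 q14
  have hv : Y (n + 11) ≤ 0.605 := by
    by_contra! hv
    have : Y (n + 10) ≤ 1 / 1.605 := by
      rw [y1]; exact inv_add_le (by linarith) (by linarith)
    have : 0.615 ≤ Y (n + 9) := by
      rw [y0]; exact le_inv_add (by linarith) (by linarith)
    linarith
  have e13 : b (n + 13) = 1 := by
    refine (h.digit (n + 11)).resolve_right fun e => ?_
    have : Y (n + 12) ≤ 1 / 3 := by
      rw [h.Y_eq_three e]; exact inv_add_le (by linarith) (by linarith)
    have : 3 / 4 ≤ Y (n + 11) := by
      rw [y2]; exact le_inv_add (by linarith) (by linarith)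
    linarith
  refine ⟨e13, (h.digit (n + 12)).resolve_left fun e => ?_⟩
  have : 0.56 ≤ Y (n + 13) := by
    rw [h.Y_eq_one e]; exact le_inv_add (by linarith) (by linarith)
  have : Y (n + 12) ≤ 1 / 1.56 := by
    rw [h.Y_eq_one e13]; exact inv_add_le (by linarith) (by linarith)
  have : 1.56 / 2.56 ≤ Y (n + 11) := by
    rw [y2]; exact le_inv_add (by linarith) (by linarith)
  linarith

theorem short_block (h : Admissible b X Y) {n : ℕ} (hb : b (n + 12) = 3) (hb' : b (n + 9) = 1) :
    b (n + 15) = 3 ∧ b (n + 18) = 1 := by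
  obtain ⟨h1, -, -⟩ := h.bounds_three hb
  obtain ⟨l1, l2⟩ := h.left_of_three hb
  obtain ⟨r1, r2⟩ := h.right_of_three hb
  have w := h.X_le' (n + 1)
  have w' := h.X_pos (n + 9)
  have v : 0.56024 ≤ X (n + 10) := by
    rw [h.X_eq_one hb']; exact le_inv_add (by linarith) (by linarith)
  have x1 : X (n + 11) ≤ 1 / 1.56024 := by
    rw [h.X_eq_one l2]; exact inv_add_le (by linarith) (by linarith)
  have x1' := h.X_pos (n + 11)
  have x : 0.6094 ≤ X (n + 12) := by
    rw [h.X_eq_one l1]; exact le_inv_add (by linarith) (by linarith)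
  have y0 : Y (n + 12) = (1 + Y (n + 13))⁻¹ := h.Y_eq_one r1
  have y1 : Y (n + 13) = (1 + Y (n + 14))⁻¹ := h.Y_eq_one r2
  have p13 := h.Y_pos (n + 13)
  have p14 := h.Y_pos (n + 14)
  have hu : Y (n + 14) ≤ 0.2795 := by
    by_contra! hu
    have : Y (n + 13) ≤ 1 / 1.2795 := by
      rw [y1]; exact inv_add_le (by linarith) (by linarith)
    have : 0.5612 ≤ Y (n + 12) := by
      rw [y0]; exact le_inv_add (by linarith) (by linarith)
    linarith
  have e15 : b (n + 15) = 3 := by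
    refine (h.digit (n + 13)).resolve_left fun e => ?_
    have := h.Y_lt (n + 15)
    have := h.Y_pos (n + 15)
    have : 1 / 2 ≤ Y (n + 14) := by
      rw [h.Y_eq_one e]; exact le_inv_add (by linarith) (by linarith)
    linarith
  refine ⟨e15, (h.digit (n + 16)).resolve_right fun e => ?_⟩
  obtain ⟨s1, s2⟩ := h.right_of_three e15
  have p16 := h.Y_pos (n + 16)
  have p15 := h.Y_pos (n + 15)
  have p18 := h.Y_pos (n + 18)
  have : Y (n + 17) ≤ 1 / 3 := by
    rw [h.Y_eq_three e]; exact inv_add_le (by linarith) (by linarith)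
  have p17 := h.Y_pos (n + 17)
  have : 3 / 4 ≤ Y (n + 16) := by
    rw [h.Y_eq_one s2]; exact le_inv_add (by linarith) (by linarith)
  have : Y (n + 15) ≤ 1 / 1.75 := by
    rw [h.Y_eq_one s1]; exact inv_add_le (by linarith) (by linarith)
  have : 0.28 ≤ Y (n + 14) := by
    rw [h.Y_eq_three e15]; exact le_inv_add (by linarith) (by linarith)
  linarith

theorem eventually_periodic (h : Admissible b X Y) : ∃ M : ℕ, (∀ k, b (M + k) = 1) ∨
    (∀ k, b (M + k) = if k % 3 = 0 then 3 else 1) ∨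
    (∀ k, b (M + k) = if k % 8 = 0 ∨ k % 8 = 5 then 3 else 1) := by
  by_cases hA : ∃ n, b (n + 9) = 3 ∧ b (n + 12) = 1
  · obtain ⟨n, h0, h3⟩ := hA
    have step : ∀ m, b (m + 9) = 3 ∧ b (m + 12) = 1 →
        b (m + 10) = 1 ∧ b (m + 11) = 1 ∧ b (m + 13) = 1 ∧ b (m + 14) = 3 ∧ b (m + 15) = 1 ∧
          b (m + 16) = 1 ∧ b (m + 17) = 3 ∧ b (m + 20) = 1 := by
      rintro m ⟨h0, h3⟩
      obtain ⟨h1, h2⟩ := h.right_of_three h0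
      obtain ⟨h4, h5⟩ := h.long_block h0 h3
      obtain ⟨h6, h7⟩ := h.right_of_three h5
      obtain ⟨h8, h11⟩ := h.short_block (n := m + 2) h5 h2
      exact ⟨h1, h2, h4, h5, h6, h7, h8, h11⟩
    have hj : ∀ j, b (n + 8 * j + 9) = 3 ∧ b (n + 8 * j + 12) = 1 := by
      intro j
      induction j with
      | zero => exact ⟨h0, h3⟩
      | succ j ih =>
        obtain ⟨-, -, -, -, -, -, h8, h11⟩ := step _ ih
        exact ⟨h8, h11⟩
    refine ⟨n + 9, Or.inr (Or.inr fun k => ?_)⟩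
    obtain ⟨h0, h3⟩ := hj (k / 8)
    obtain ⟨h1, h2, h4, h5, h6, h7, -⟩ := step _ (hj (k / 8))
    have hk := Nat.div_add_mod k 8
    have hlt := Nat.mod_lt k (show 8 > 0 by norm_num)
    generalize k / 8 = j at *
    generalize k % 8 = r at *
    subst hk
    interval_cases r <;> norm_num <;> ring_nf at * <;> assumption
  · push Not at hA
    by_cases hB : ∃ n, b (n + 9) = 3
    · obtain ⟨n, h0⟩ := hB
      have hj : ∀ j, b (n + 3 * j + 9) = 3 := by
        intro j
        induction j with
        | zero => exact h0
        | succ j ih => exact (h.digit (n + 3 * j + 10)).resolve_left (hA _ ih)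
      refine ⟨n + 9, Or.inr (Or.inl fun k => ?_)⟩
      have h0 := hj (k / 3)
      obtain ⟨h1, h2⟩ := h.right_of_three h0
      have hk := Nat.div_add_mod k 3
      have hlt := Nat.mod_lt k (show 3 > 0 by norm_num)
      generalize k / 3 = j at *
      generalize k % 3 = r at *
      subst hk
      interval_cases r <;> norm_num <;> ring_nf at * <;> assumption
    · push Not at hB
      refine ⟨9, Or.inl fun k => ?_⟩
      rw [add_comm]
      exact (h.digit (k + 7)).resolve_right (hB k)

end Admissible

theorem val_two_mul {α : ℝ} (hα : Irrational α) (n : ℕ) :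
    ((2 * cfDen α (n + 1) : ℤ) : ℝ) *
        |((2 * cfDen α (n + 1) : ℤ) : ℝ) * α - ((2 * cfNum α (n + 1) : ℤ) : ℝ)| =
      4 / (cfDigit α (n + 2) + denRatio α n + cfFront α n) := by
  have h := mul_abs_combination hα n 0 2
  have e : ((2 * cfDen α (n + 1) : ℤ) : ℝ) * α - ((2 * cfNum α (n + 1) : ℤ) : ℝ) =
      0 * cfErr α (n + 2) + 2 * cfErr α (n + 1) := by
    simp only [cfErr]; push_cast; ring
  rw [e]
  norm_num at h ⊢
  exact h

theorem val_intermediate {α : ℝ} (hα : Irrational α) (n : ℕ) {m : ℤ} (hm : 0 ≤ m) :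
    ((cfDen α (n + 2) - m * cfDen α (n + 1) : ℤ) : ℝ) *
        |((cfDen α (n + 2) - m * cfDen α (n + 1) : ℤ) : ℝ) * α -
          ((cfNum α (n + 2) - m * cfNum α (n + 1) : ℤ) : ℝ)| =
      (cfDigit α (n + 2) + denRatio α n - m) * (m + cfFront α n) /
        (cfDigit α (n + 2) + denRatio α n + cfFront α n) := by
  have h := mul_abs_combination hα n 1 (-m)
  have e : ((cfDen α (n + 2) - m * cfDen α (n + 1) : ℤ) : ℝ) * α -
      ((cfNum α (n + 2) - m * cfNum α (n + 1) : ℤ) : ℝ) =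
      1 * cfErr α (n + 2) + -m * cfErr α (n + 1) := by
    simp only [cfErr]; push_cast; ring
  have hm' : (0 : ℝ) ≤ m := by exact_mod_cast hm
  have hY := cfFront_pos hα n
  rw [e]
  rw [abs_of_nonneg (show 0 ≤ 1 * cfFront α n - -(m : ℝ) by linarith)] at h
  push_cast
  rw [show (cfDen α (n + 2) - m * cfDen α (n + 1) : ℝ) =
    1 * cfDen α (n + 2) + -m * cfDen α (n + 1) by ring, h]
  ring

theorem notConvergent_intermediate {α : ℝ} (hα : Irrational α) (n : ℕ) {m : ℤ} (hm : 1 ≤ m)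
    (hm' : m + 1 ≤ cfDigit α (n + 2)) :
    NotConvergent α (cfNum α (n + 2) - m * cfNum α (n + 1))
      (cfDen α (n + 2) - m * cfDen α (n + 1)) := by
  have h0 := cfDen_pos hα n
  have h1 := cfDen_pos hα (n + 1)
  refine notConvergent_of_lt hα (n := n + 1) ?_ ?_
  · rw [cfDen]; nlinarith
  · show _ < cfDen α (n + 2)
    nlinarith

theorem exists_admissible {α : ℝ} (hα : Irrational α) (hk : 0.9591 < kConst α) :
    ∃ N : ℕ, Admissible (fun n => cfDigit α (N + n + 3)) (fun n => denRatio α (N + n + 1))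
      (fun n => cfFront α (N + n + 1)) := by
  obtain ⟨K, hK⟩ := le_of_lt_kConst hk
  have hden : ∀ n, K ≤ cfDen α (K.toNat + n) := fun n => by
    have := le_cfDen hα (K.toNat + n)
    push_cast at this
    omega
  have hpos : ∀ n, 0 < cfDigit α (n + 2) + denRatio α n + cfFront α n := fun n => by
    have ha : (1 : ℝ) ≤ cfDigit α (n + 2) := by exact_mod_cast one_le_cfDigit_succ hα (n + 1)
    have := cfFront_pos hα n
    have := denRatio_pos hα n
    positivity
  have key : ∀ n, ∀ m : ℤ, 1 ≤ m → m + 1 ≤ cfDigit α (K.toNat + n + 3) →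
      0.9591 * (cfDigit α (K.toNat + n + 3) + denRatio α (K.toNat + n + 1) +
        cfFront α (K.toNat + n + 1)) ≤ (cfDigit α (K.toNat + n + 3) +
          denRatio α (K.toNat + n + 1) - m) * (m + cfFront α (K.toNat + n + 1)) := by
    intro n m h1 h2
    have h := hK _ _ ?_ (notConvergent_intermediate hα (K.toNat + n + 1) h1 h2)
    · rwa [val_intermediate hα _ (by omega), le_div_iff₀ (hpos _)] at h
    · have hd1 := hden (n + 1)
      have hd0 := cfDen_pos hα (K.toNat + n + 1)
      have hd2 := cfDen_pos hα (K.toNat + n + 2)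
      have e : cfDen α (K.toNat + n + 1 + 2) = cfDigit α (K.toNat + n + 3) *
        cfDen α (K.toNat + n + 2) + cfDen α (K.toNat + n + 1) := rfl
      rw [e, show K.toNat + n + 1 + 1 = K.toNat + n + 2 from rfl]
      rw [← add_assoc] at hd1
      nlinarith
  refine ⟨K.toNat, fun n => one_le_cfDigit_succ hα _, fun n => denRatio_pos hα _,
    fun n => denRatio_succ_lt_one hα _, fun n => cfFront_pos hα _, fun n => cfFront_lt_one hα _,
    fun n => denRatio_succ hα _, fun n => cfFront_eq α _, fun n => ?_, fun n hn => ?_,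
    fun n hn => ?_⟩
  · have h := hK _ _ ?_ (notConvergent_two_mul α (K.toNat + n + 1 + 1))
    · rwa [val_two_mul hα, le_div_iff₀ (hpos _)] at h
    · have := hden (n + 2)
      have h0 := cfDen_pos hα (K.toNat + n + 1 + 1)
      rw [← add_assoc] at this
      change K ≤ cfDen α (K.toNat + n + 1 + 1) at this
      omega
  · have h := key n (cfDigit α (K.toNat + n + 3) - 1) (by omega) (by omega)
    push_cast at h
    linear_combination h
  · have h := key n 1 le_rfl hn
    push_cast at h
    linear_combination h

theorem one_le_or_eq_of_combination {A B : ℝ} (hA : 0 < A) (hB : 0 < B) {x y : ℤ}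
    (h1 : B ≤ x + y * B) (h2 : x + y * B < 1) :
    (x = 0 ∧ 1 ≤ y) ∨ (x = 1 ∧ y ≤ -1) ∨ A + B ≤ (x + y * B) * |x - y * A| := by
  rcases lt_trichotomy x 0 with hx | rfl | hx
  · right; right
    have hx' : (x : ℝ) ≤ -1 := by exact_mod_cast (by omega : x ≤ -1)
    have h3 : A + B ≤ B * (y * A - x) := by nlinarith
    have h4 : 0 < y * A - x := by
      by_contra! h
      nlinarith
    calc A + B ≤ B * (y * A - x) := h3
      _ ≤ (x + y * B) * (y * A - x) := mul_le_mul_of_nonneg_right h1 h4.le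
      _ = (x + y * B) * |x - y * A| := by rw [abs_sub_comm, abs_of_pos h4]
  · left
    refine ⟨rfl, ?_⟩
    by_contra! hy
    have hy' : (y : ℝ) ≤ 0 := by exact_mod_cast (by omega : y ≤ 0)
    push_cast at h1
    nlinarith
  · right
    have hx' : (1 : ℝ) ≤ x := by exact_mod_cast hx
    have hy : y < 0 := by
      by_contra! hy
      have hy' : (0 : ℝ) ≤ y := by exact_mod_cast hy
      nlinarith
    rcases eq_or_lt_of_le (show 1 ≤ x by omega) with rfl | hx2
    · exact Or.inl ⟨rfl, by omega⟩
    · right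
      have hx3 : (2 : ℝ) ≤ x := by exact_mod_cast hx2
      have hy' : (y : ℝ) ≤ -1 := by exact_mod_cast (by omega : y ≤ -1)
      have h4 : 0 < x - y * A := by nlinarith
      calc A + B ≤ B * (x - y * A) := by nlinarith
        _ ≤ (x + y * B) * (x - y * A) := mul_le_mul_of_nonneg_right h1 h4.le
        _ = (x + y * B) * |x - y * A| := by rw [abs_of_pos h4]

theorem val_lower_bound {α : ℝ} (hα : Irrational α) {p q : ℤ} (hpq : NotConvergent α p q) {n : ℕ}
    (h1 : cfDen α (n + 1) ≤ q) (h2 : q < cfDen α (n + 2)) :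
    1 ≤ q * |(q : ℝ) * α - p| ∨
    4 / (cfDigit α (n + 2) + denRatio α n + cfFront α n) ≤ q * |(q : ℝ) * α - p| ∨
    ∃ m : ℤ, 1 ≤ m ∧ m + 1 ≤ cfDigit α (n + 2) + denRatio α n ∧ q * |(q : ℝ) * α - p| =
      (cfDigit α (n + 2) + denRatio α n - m) * (m + cfFront α n) /
        (cfDigit α (n + 2) + denRatio α n + cfFront α n) := by
  have hd : cfNum α (n + 2) * cfDen α (n + 1) - cfNum α (n + 1) * cfDen α (n + 2) =
    (-1) ^ (n + 1) := cfNum_mul_cfDen_sub α (n + 1)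
  have hsq : ((-1 : ℤ) ^ (n + 1)) * (-1) ^ (n + 1) = 1 := by
    rw [← mul_pow]; norm_num
  set D : ℤ := (-1) ^ (n + 1)
  obtain ⟨x, y, hp, hq⟩ : ∃ x y : ℤ, p = x * cfNum α (n + 2) + y * cfNum α (n + 1) ∧
      q = x * cfDen α (n + 2) + y * cfDen α (n + 1) := by
    refine ⟨D * (p * cfDen α (n + 1) - q * cfNum α (n + 1)),
      D * (q * cfNum α (n + 2) - p * cfDen α (n + 2)), ?_, ?_⟩
    · linear_combination (-D * p) * hd - p * hsq
    · linear_combination (-D * q) * hd - q * hsq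
  have hY := cfFront_pos hα n
  have hX := denRatio_pos hα n
  have ha : (1 : ℝ) ≤ cfDigit α (n + 2) := by exact_mod_cast one_le_cfDigit_succ hα (n + 1)
  have hden : (0 : ℝ) < cfDen α (n + 1) := by exact_mod_cast cfDen_pos hα (n + 1)
  have hc : 0 < cfDigit α (n + 2) + denRatio α n := by positivity
  have hs : 0 < cfDigit α (n + 2) + denRatio α n + cfFront α n := by positivity
  have hQ : (cfDen α (n + 2) : ℝ) = (cfDigit α (n + 2) + denRatio α n) * cfDen α (n + 1) := by
    rw [cfDen, denRatio]; push_cast; field_simp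
  have hval : q * |(q : ℝ) * α - p| =
      (x * (cfDigit α (n + 2) + denRatio α n) + y) * |x * cfFront α n - y| /
        (cfDigit α (n + 2) + denRatio α n + cfFront α n) := by
    rw [← mul_abs_combination hα n x y, hp, hq]
    simp only [cfErr]
    push_cast
    congr 2
    ring
  have h1' : (cfDen α (n + 1) : ℝ) ≤ q := by exact_mod_cast h1
  have h2' : (q : ℝ) < cfDen α (n + 2) := by exact_mod_cast h2
  rw [hq] at h1' h2'
  push_cast at h1' h2'
  rw [hQ] at h1' h2'
  generalize cfDigit α (n + 2) + denRatio α n = c at *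
  generalize cfFront α n = Y at *
  generalize (cfDen α (n + 1) : ℝ) = Q at *
  have g1 : 1 ≤ x * c + y := by
    by_contra! h
    nlinarith
  have g2 : x * c + y < c := by
    by_contra! h
    nlinarith
  have k1 : c⁻¹ ≤ x + y * c⁻¹ := by
    rw [← sub_nonneg]
    have : x + y * c⁻¹ - c⁻¹ = (x * c + y - 1) * c⁻¹ := by field_simp
    rw [this]; exact mul_nonneg (by linarith) (inv_pos.2 hc).le
  have k2 : x + y * c⁻¹ < 1 := by
    rw [← sub_pos]
    have : 1 - (x + y * c⁻¹) = (c - (x * c + y)) * c⁻¹ := by field_simp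
    rw [this]; exact mul_pos (by linarith) (inv_pos.2 hc)
  rcases one_le_or_eq_of_combination (inv_pos.2 hY) (inv_pos.2 hc) k1 k2 with
    ⟨rfl, hy⟩ | ⟨rfl, hy⟩ | h
  · right; left
    have hy2 : 2 ≤ y := by
      rcases eq_or_lt_of_le hy with rfl | hy
      · exact absurd (by simp [hp, hq]) (hpq (n + 1))
      · omega
    have hy2' : (2 : ℝ) ≤ y := by exact_mod_cast hy2
    rw [hval]
    gcongr
    push_cast
    rw [show (0 : ℝ) * Y - y = -y by ring, abs_neg, abs_of_nonneg (by linarith)]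
    nlinarith
  · right; right
    refine ⟨-y, by omega, by push_cast at *; linarith, ?_⟩
    have hy' : (y : ℝ) ≤ -1 := by exact_mod_cast hy
    rw [hval]
    push_cast
    rw [one_mul, one_mul, abs_of_nonneg (by linarith)]
    ring
  · left
    rw [hval, le_div_iff₀ hs, one_mul]
    have e : (x * c + y) * |x * Y - y| = c * Y * ((x + y * c⁻¹) * |x - y * Y⁻¹|) := by
      have : (x : ℝ) * Y - y = Y * (x - y * Y⁻¹) := by field_simp
      rw [this, abs_mul, abs_of_pos hY]
      field_simp
    rw [e]
    calc c + Y = c * Y * (Y⁻¹ + c⁻¹) := by field_simp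
      _ ≤ _ := mul_le_mul_of_nonneg_left h (by positivity)

theorem cfTail_step {β s D P Q P' Q' : ℝ} {n : ℕ} {d : ℤ} (h : cfTail β n = (P + s) / Q)
    (hs : s * s = D) (hP : P' = d * Q - P) (hQ : Q * Q' = D - P' * P') (hQ0 : Q ≠ 0)
    (hQ' : 0 < Q') (h1 : Q' < P' + s) :
    cfDigit β n = d ∧ cfTail β (n + 1) = (P' + s) / Q' := by
  have hpos : 0 < P' + s := hQ'.trans h1
  have e : cfTail β n = d + Q' / (P' + s) := by
    rw [h]
    field_simp
    linear_combination (P' + s) * hP - hQ + hs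
  have hd : cfDigit β n = d := by
    rw [cfDigit, Int.floor_eq_iff, e]
    have h2 : 0 < Q' / (P' + s) := by positivity
    have h3 : Q' / (P' + s) < 1 := (div_lt_one hpos).2 h1
    constructor <;> linarith
  refine ⟨hd, ?_⟩
  have := cfTail_eq β n
  rw [hd, e, add_right_inj] at this
  rw [← inv_inv (cfTail β (n + 1)), ← this, inv_div]

theorem cfDigit_golden (k : ℕ) : cfDigit ((1 + √5) / 2) k = 1 := by
  have hs : √5 * √5 = 5 := Real.mul_self_sqrt (by norm_num)
  have hs0 : 0 ≤ √5 := Real.sqrt_nonneg 5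
  have h1 : 2 < √5 := by nlinarith
  have step : ∀ n, cfTail ((1 + √5) / 2) n = (1 + √5) / 2 →
      cfDigit ((1 + √5) / 2) n = 1 ∧ cfTail ((1 + √5) / 2) (n + 1) = (1 + √5) / 2 := fun n h =>
    cfTail_step h hs (by norm_num) (by norm_num) (by norm_num) (by norm_num) (by linarith)
  have hT : ∀ n, cfTail ((1 + √5) / 2) n = (1 + √5) / 2 := by
    intro n
    induction n with
    | zero => rfl
    | succ n ih => exact (step n ih).2
  exact (step k (hT k)).1

theorem cfDigit_sqrt_seventeen (k : ℕ) :
    cfDigit ((1 + √17) / 2) (3 + k) = if k % 3 = 0 then 3 else 1 := by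
  have hs : √17 * √17 = 17 := Real.mul_self_sqrt (by norm_num)
  have hs0 : 0 ≤ √17 := Real.sqrt_nonneg 17
  have h1 : 4 < √17 := by nlinarith
  set β := (1 + √17) / 2 with hβ
  have s0 : ∀ n, cfTail β n = (3 + √17) / 2 →
      cfDigit β n = 3 ∧ cfTail β (n + 1) = (3 + √17) / 4 := fun n h =>
    cfTail_step h hs (by norm_num) (by norm_num) (by norm_num) (by norm_num) (by linarith)
  have s1 : ∀ n, cfTail β n = (3 + √17) / 4 →
      cfDigit β n = 1 ∧ cfTail β (n + 1) = (1 + √17) / 4 := fun n h =>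
    cfTail_step h hs (by norm_num) (by norm_num) (by norm_num) (by norm_num) (by linarith)
  have s2 : ∀ n, cfTail β n = (1 + √17) / 4 →
      cfDigit β n = 1 ∧ cfTail β (n + 1) = (3 + √17) / 2 := fun n h =>
    cfTail_step h hs (by norm_num) (by norm_num) (by norm_num) (by norm_num) (by linarith)
  have hT : ∀ j, cfTail β (3 * j + 3) = (3 + √17) / 2 := by
    intro j
    induction j with
    | zero =>
      have : cfDigit β 0 = 2 ∧ cfTail β (0 + 1) = (3 + √17) / 4 :=
        cfTail_step (P := 1) (Q := 2) hβ hs (by norm_num) (by norm_num) (by norm_num)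
          (by norm_num) (by linarith)
      exact (s2 _ (s1 _ this.2).2).2
    | succ j ih => exact (s2 _ (s1 _ (s0 _ ih).2).2).2
  obtain ⟨d0, t1⟩ := s0 _ (hT (k / 3))
  obtain ⟨d1, t2⟩ := s1 _ t1
  obtain ⟨d2, -⟩ := s2 _ t2
  have hk := Nat.div_add_mod k 3
  have hlt := Nat.mod_lt k (show 3 > 0 by norm_num)
  generalize k / 3 = j at *
  generalize k % 3 = r at *
  subst hk
  interval_cases r <;> norm_num <;> ring_nf at d0 d1 d2 ⊢ <;> assumption

theorem thirteen_mul_sqrt_bounds : 13 * √173 * (13 * √173) = 29237 ∧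
    170.988 < 13 * √173 ∧ 13 * √173 < 170.99 := by
  have hs : √173 * √173 = 173 := Real.mul_self_sqrt (by norm_num)
  have hs0 : 0 ≤ √173 := Real.sqrt_nonneg 173
  refine ⟨by linear_combination 169 * hs, ?_, ?_⟩ <;> nlinarith

theorem cfDigit_sqrt_oneHundredSeventyThree (k : ℕ) :
    cfDigit ((13 * √173 + 39) / 82) (3 + k) = if k % 8 = 0 ∨ k % 8 = 5 then 3 else 1 := by
  obtain ⟨hs, h1, h2⟩ := thirteen_mul_sqrt_bounds
  rw [add_comm (13 * √173) 39]
  generalize 13 * √173 = s at *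
  set β := (39 + s) / 82 with hβ
  have s1 : ∀ n, cfTail β n = (125 + s) / 166 →
      cfDigit β n = 1 ∧ cfTail β (n + 1) = (41 + s) / 166 := fun n h =>
    cfTail_step h hs (by norm_num) (by norm_num) (by norm_num) (by norm_num) (by linarith)
  have s2 : ∀ n, cfTail β n = (41 + s) / 166 →
      cfDigit β n = 1 ∧ cfTail β (n + 1) = (125 + s) / 82 := fun n h =>
    cfTail_step h hs (by norm_num) (by norm_num) (by norm_num) (by norm_num) (by linarith)
  have s3 : ∀ n, cfTail β n = (125 + s) / 82 →
      cfDigit β n = 3 ∧ cfTail β (n + 1) = (121 + s) / 178 := fun n h =>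
    cfTail_step h hs (by norm_num) (by norm_num) (by norm_num) (by norm_num) (by linarith)
  have s4 : ∀ n, cfTail β n = (121 + s) / 178 →
      cfDigit β n = 1 ∧ cfTail β (n + 1) = (57 + s) / 146 := fun n h =>
    cfTail_step h hs (by norm_num) (by norm_num) (by norm_num) (by norm_num) (by linarith)
  have s5 : ∀ n, cfTail β n = (57 + s) / 146 →
      cfDigit β n = 1 ∧ cfTail β (n + 1) = (89 + s) / 146 := fun n h =>
    cfTail_step h hs (by norm_num) (by norm_num) (by norm_num) (by norm_num) (by linarith)
  have s6 : ∀ n, cfTail β n = (89 + s) / 146 →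
      cfDigit β n = 1 ∧ cfTail β (n + 1) = (57 + s) / 178 := fun n h =>
    cfTail_step h hs (by norm_num) (by norm_num) (by norm_num) (by norm_num) (by linarith)
  have s7 : ∀ n, cfTail β n = (57 + s) / 178 →
      cfDigit β n = 1 ∧ cfTail β (n + 1) = (121 + s) / 82 := fun n h =>
    cfTail_step h hs (by norm_num) (by norm_num) (by norm_num) (by norm_num) (by linarith)
  have s8 : ∀ n, cfTail β n = (121 + s) / 82 →
      cfDigit β n = 3 ∧ cfTail β (n + 1) = (125 + s) / 166 := fun n h =>
    cfTail_step h hs (by norm_num) (by norm_num) (by norm_num) (by norm_num) (by linarith)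
  have hT : ∀ j, cfTail β (8 * j + 3) = (125 + s) / 82 := by
    intro j
    induction j with
    | zero =>
      have : cfDigit β 0 = 2 ∧ cfTail β (0 + 1) = (125 + s) / 166 :=
        cfTail_step (P := 39) (Q := 82) hβ hs (by norm_num) (by norm_num) (by norm_num)
          (by norm_num) (by linarith)
      exact (s2 _ (s1 _ this.2).2).2
    | succ j ih =>
      exact (s2 _ (s1 _ (s8 _ (s7 _ (s6 _ (s5 _ (s4 _ (s3 _ ih).2).2).2).2).2).2).2).2
  obtain ⟨d0, t1⟩ := s3 _ (hT (k / 8))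
  obtain ⟨d1, t2⟩ := s4 _ t1
  obtain ⟨d2, t3⟩ := s5 _ t2
  obtain ⟨d3, t4⟩ := s6 _ t3
  obtain ⟨d4, t5⟩ := s7 _ t4
  obtain ⟨d5, t6⟩ := s8 _ t5
  obtain ⟨d6, t7⟩ := s1 _ t6
  obtain ⟨d7, -⟩ := s2 _ t7
  have hk := Nat.div_add_mod k 8
  have hlt := Nat.mod_lt k (show 8 > 0 by norm_num)
  clear t1 t2 t3 t4 t5 t6 t7 hT s1 s2 s3 s4 s5 s6 s7 s8
  generalize k / 8 = j at *
  generalize k % 8 = r at *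
  subst hk
  clear_value β
  interval_cases r <;> norm_num <;> ring_nf at d0 d1 d2 d3 d4 d5 d6 d7 ⊢ <;> assumption

theorem cfEquiv_of_forall {α β : ℝ} {M N : ℕ} (hM : 0 < M) (hN : 0 < N)
    (h : ∀ k, cfDigit α (M + k) = cfDigit β (N + k)) : CFEquiv α β :=
  ⟨M, N, hM, hN, fun k _ => h k⟩

theorem cfEquiv_of_lt_kConst {α : ℝ} (hα : Irrational α)
    (h5 : ¬ CFEquiv α ((1 + √5) / 2)) (h17 : ¬ CFEquiv α ((1 + √17) / 2))
    (hk : 0.9591 < kConst α) : CFEquiv α ((13 * √173 + 39) / 82) := by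
  obtain ⟨N, hN⟩ := exists_admissible hα hk
  have e : ∀ M k, cfDigit α (N + (M + k) + 3) = cfDigit α (N + M + 3 + k) := fun M k => by
    congr 1; omega
  obtain ⟨M, h | h | h⟩ := hN.eventually_periodic
  · refine absurd (cfEquiv_of_forall (M := N + M + 3) (N := 1) (by omega) one_pos fun k => ?_) h5
    rw [cfDigit_golden, ← e, h]
  · refine absurd (cfEquiv_of_forall (M := N + M + 3) (N := 3) (by omega) (by omega)
      fun k => ?_) h17
    rw [cfDigit_sqrt_seventeen, ← e, h]
  · refine cfEquiv_of_forall (M := N + M + 3) (N := 3) (by omega) (by omega) fun k => ?_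
    rw [cfDigit_sqrt_oneHundredSeventyThree, ← e, h]

theorem abs_inv_add_sub_le {d z w : ℝ} (hd : 1 ≤ d) (hz : 0 < z) (hw : 0 < w) :
    |(d + z)⁻¹ - (d + w)⁻¹| ≤ |z - w| / (d * d) := by
  have h1 : 0 < d + z := by linarith
  have h2 : 0 < d + w := by linarith
  rw [inv_sub_inv h1.ne' h2.ne', abs_div, abs_of_pos (mul_pos h1 h2),
    show d + w - (d + z) = -(z - w) by ring, abs_neg]
  apply div_le_div_of_nonneg_left (abs_nonneg _) (by positivity)
  nlinarith

theorem abs_inv_one_add_sub_le {z w : ℝ} (hz : 0 < z) (hw : 0 < w) :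
    |(1 + z)⁻¹ - (1 + w)⁻¹| ≤ |z - w| := by
  simpa using abs_inv_add_sub_le le_rfl hz hw

theorem abs_inv_three_add_sub_le {z w : ℝ} (hz : 0 < z) (hw : 0 < w) :
    |(3 + z)⁻¹ - (3 + w)⁻¹| ≤ 1 / 9 * |z - w| := by
  have := abs_inv_add_sub_le (d := 3) (by norm_num) hz hw
  linarith

/-- The value `[0; 1, 1, 3 + z]`. -/
noncomputable def shortBlock (z : ℝ) : ℝ := (1 + (1 + (3 + z)⁻¹)⁻¹)⁻¹

/-- The value `[0; 1, 1, 1, 1, 3 + z]`. -/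
noncomputable def longBlock (z : ℝ) : ℝ := (1 + (1 + (1 + (1 + (3 + z)⁻¹)⁻¹)⁻¹)⁻¹)⁻¹

theorem abs_shortBlock_sub_le {z w : ℝ} (hz : 0 < z) (hw : 0 < w) :
    |shortBlock z - shortBlock w| ≤ 1 / 9 * |z - w| :=
  (abs_inv_one_add_sub_le (by positivity) (by positivity)).trans <|
    (abs_inv_one_add_sub_le (by positivity) (by positivity)).trans <|
      abs_inv_three_add_sub_le hz hw

theorem abs_longBlock_sub_le {z w : ℝ} (hz : 0 < z) (hw : 0 < w) :
    |longBlock z - longBlock w| ≤ 1 / 9 * |z - w| :=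
  (abs_inv_one_add_sub_le (by positivity) (by positivity)).trans <|
    (abs_inv_one_add_sub_le (by positivity) (by positivity)).trans <|
      (abs_inv_one_add_sub_le (by positivity) (by positivity)).trans <|
        (abs_inv_one_add_sub_le (by positivity) (by positivity)).trans <|
          abs_inv_three_add_sub_le hz hw

theorem shortBlock_eq {s : ℝ} (hs : s * s = 29237) (h1 : 170.9 < s) :
    shortBlock ((s - 121) / 82) = (s - 125) / 82 := by
  have h : 0 < s + 125 := by linarith
  have h2 : 0 < s + 207 := by linarith
  have h3 : 0 < s + 166 := by linarith
  rw [shortBlock, show 3 + (s - 121) / 82 = (s + 125) / 82 by ring, inv_div,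
    show 1 + 82 / (s + 125) = (s + 207) / (s + 125) by field_simp; ring, inv_div,
    show 1 + (s + 125) / (s + 207) = 2 * (s + 166) / (s + 207) by field_simp; ring, inv_div,
    div_eq_div_iff (by positivity) (by norm_num)]
  linear_combination (-2) * hs

theorem longBlock_eq {s : ℝ} (hs : s * s = 29237) (h1 : 170.9 < s) :
    longBlock ((s - 125) / 82) = (s - 121) / 82 := by
  have h : 0 < s + 121 := by linarith
  have h2 : 0 < s + 203 := by linarith
  have h3 : 0 < s + 162 := by linarith
  have h4 : 0 < 3 * s + 527 := by linarith
  have h5 : 0 < 5 * s + 851 := by linarith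
  rw [longBlock, show 3 + (s - 125) / 82 = (s + 121) / 82 by ring, inv_div,
    show 1 + 82 / (s + 121) = (s + 203) / (s + 121) by field_simp; ring, inv_div,
    show 1 + (s + 121) / (s + 203) = 2 * (s + 162) / (s + 203) by field_simp; ring, inv_div,
    show 1 + (s + 203) / (2 * (s + 162)) = (3 * s + 527) / (2 * (s + 162)) by
      field_simp; ring, inv_div,
    show 1 + 2 * (s + 162) / (3 * s + 527) = (5 * s + 851) / (3 * s + 527) by
      field_simp; ring, inv_div,
    div_eq_div_iff (by positivity) (by norm_num)]
  linear_combination (-5) * hs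

theorem near_of_digits {α : ℝ} (hα : Irrational α) {M : ℕ}
    (h : ∀ k, cfDigit α (M + k) = if k % 8 = 0 ∨ k % 8 = 5 then 3 else 1)
    {s : ℝ} (hs : s * s = 29237) (h1 : 170.9 < s) (h2 : s < 171) (k j : ℕ) (hkj : k ≤ j) :
    (|denRatio α (M + 8 * j + 6) - (s - 125) / 82| ≤ (1 / 9) ^ k ∧
      |denRatio α (M + 8 * j + 11) - (s - 121) / 82| ≤ (1 / 9) ^ k) ∧
    |cfFront α (M + 8 * j + 6) - (s - 121) / 82| ≤ (1 / 9) ^ k ∧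
      |cfFront α (M + 8 * j + 11) - (s - 125) / 82| ≤ (1 / 9) ^ k := by
  have hU0 : 0 < (s - 125) / 82 := by linarith
  have hV0 : 0 < (s - 121) / 82 := by linarith
  have hU1 : (s - 125) / 82 < 1 := by linarith
  have hV1 : (s - 121) / 82 < 1 := by linarith
  have eU := shortBlock_eq hs h1
  have eV := longBlock_eq hs h1
  generalize (s - 125) / 82 = U at *
  generalize (s - 121) / 82 = V at *
  have d : ∀ j r : ℕ, cfDigit α (M + 8 * j + r) =
      if r % 8 = 0 ∨ r % 8 = 5 then 3 else 1 := fun j r => by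
    rw [add_assoc, h, Nat.mul_add_mod]
  have d1 : ∀ j r : ℕ, (cfDigit α (M + 8 * j + r) : ℝ) =
      if r % 8 = 0 ∨ r % 8 = 5 then 3 else 1 := fun j r => by
    rw [d]; split_ifs <;> norm_num
  have hx : ∀ j r : ℕ, denRatio α (M + 8 * j + (r + 1)) =
      ((if (r + 2) % 8 = 0 ∨ (r + 2) % 8 = 5 then 3 else 1) +
        denRatio α (M + 8 * j + r))⁻¹ := fun j r => by
    rw [← d1 j (r + 2)]; exact denRatio_succ hα _
  have hy : ∀ j r : ℕ, cfFront α (M + 8 * j + r) =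
      ((if (r + 3) % 8 = 0 ∨ (r + 3) % 8 = 5 then 3 else 1) +
        cfFront α (M + 8 * j + (r + 1)))⁻¹ := fun j r => by
    rw [← d1 j (r + 3)]; exact cfFront_eq α _
  have xb : ∀ j, denRatio α (M + 8 * j + 11) = longBlock (denRatio α (M + 8 * j + 6)) := by
    intro j
    have e7 := hx j 6
    have e8 := hx j 7
    have e9 := hx j 8
    have e10 := hx j 9
    have e11 := hx j 10
    norm_num only [or_false, or_true, false_or, true_or, if_true, if_false] at e7 e8 e9 e10 e11
    rw [longBlock, e11, e10, e9, e8, e7]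
  have xa : ∀ j, denRatio α (M + 8 * (j + 1) + 6) = shortBlock (denRatio α (M + 8 * j + 11)) := by
    intro j
    have e12 := hx j 11
    have e13 := hx j 12
    have e14 := hx j 13
    norm_num only [or_false, or_true, false_or, true_or, if_true, if_false] at e12 e13 e14
    rw [shortBlock, show M + 8 * (j + 1) + 6 = M + 8 * j + 14 by ring, e14, e13, e12]
  have ya : ∀ j, cfFront α (M + 8 * j + 6) = longBlock (cfFront α (M + 8 * j + 11)) := by
    intro j
    have e6 := hy j 6
    have e7 := hy j 7
    have e8 := hy j 8
    have e9 := hy j 9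
    have e10 := hy j 10
    norm_num only [or_false, or_true, false_or, true_or, if_true, if_false] at e6 e7 e8 e9 e10
    rw [longBlock, e6, e7, e8, e9, e10]
  have yb : ∀ j, cfFront α (M + 8 * j + 11) = shortBlock (cfFront α (M + 8 * (j + 1) + 6)) := by
    intro j
    have e11 := hy j 11
    have e12 := hy j 12
    have e13 := hy j 13
    norm_num only [or_false, or_true, false_or, true_or, if_true, if_false] at e11 e12 e13
    rw [shortBlock, show M + 8 * (j + 1) + 6 = M + 8 * j + 14 by ring, e11, e12, e13]
  have lt_one : ∀ x w : ℝ, 0 < x → x < 1 → 0 < w → w < 1 → |x - w| ≤ 1 := fun x w _ _ _ _ =>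
    abs_le.2 ⟨by linarith, by linarith⟩
  induction k generalizing j with
  | zero =>
    rw [pow_zero]
    exact ⟨⟨lt_one _ _ (denRatio_pos hα _) (denRatio_succ_lt_one hα _) hU0 hU1,
      lt_one _ _ (denRatio_pos hα _) (denRatio_succ_lt_one hα _) hV0 hV1⟩,
      lt_one _ _ (cfFront_pos hα _) (cfFront_lt_one hα _) hV0 hV1,
      lt_one _ _ (cfFront_pos hα _) (cfFront_lt_one hα _) hU0 hU1⟩
  | succ k ih =>
    obtain ⟨i, rfl⟩ : ∃ i, j = i + 1 := ⟨j - 1, by omega⟩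
    obtain ⟨⟨-, i2⟩, -, -⟩ := ih i (by omega)
    obtain ⟨⟨i5, -⟩, -, i8⟩ := ih (i + 1) (by omega)
    obtain ⟨⟨-, -⟩, i9, -⟩ := ih (i + 1 + 1) (by omega)
    rw [pow_succ]
    have c1 := abs_shortBlock_sub_le (denRatio_pos hα (M + 8 * i + 11)) hV0
    have c2 := abs_longBlock_sub_le (denRatio_pos hα (M + 8 * (i + 1) + 6)) hU0
    have c3 := abs_longBlock_sub_le (cfFront_pos hα (M + 8 * (i + 1) + 11)) hU0
    have c4 := abs_shortBlock_sub_le (cfFront_pos hα (M + 8 * (i + 1 + 1) + 6)) hV0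
    rw [← xa, eU] at c1
    rw [← xb, eV] at c2
    rw [← ya, eV] at c3
    rw [← yb, eU] at c4
    refine ⟨⟨?_, ?_⟩, ?_, ?_⟩ <;> linarith

theorem eventually_near {α : ℝ} (hα : Irrational α) {M : ℕ}
    (h : ∀ k, cfDigit α (M + k) = if k % 8 = 0 ∨ k % 8 = 5 then 3 else 1)
    {s : ℝ} (hs : s * s = 29237) (h1 : 170.9 < s) (h2 : s < 171) {δ : ℝ} (hδ : 0 < δ) :
    ∃ N, ∀ n, N ≤ n → cfDigit α (n + 2) = 1 ∨ cfDigit α (n + 2) = 3 ∧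
      ((|denRatio α n - (s - 125) / 82| ≤ δ ∧ |cfFront α n - (s - 121) / 82| ≤ δ) ∨
       (|denRatio α n - (s - 121) / 82| ≤ δ ∧ |cfFront α n - (s - 125) / 82| ≤ δ)) := by
  obtain ⟨k, hk⟩ := exists_pow_lt_of_lt_one hδ (show (1 / 9 : ℝ) < 1 by norm_num)
  refine ⟨M + 8 * k + 16, fun n hn => ?_⟩
  obtain ⟨i, rfl⟩ : ∃ i, n = M + i := ⟨n - M, by omega⟩
  rw [add_assoc, h]
  split_ifs with hi
  · refine Or.inr ⟨rfl, ?_⟩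
    rcases hi with hi | hi
    · obtain ⟨j, rfl⟩ : ∃ j, i = 8 * j + 6 := ⟨(i - 6) / 8, by omega⟩
      obtain ⟨⟨a1, -⟩, a3, -⟩ := near_of_digits hα h hs h1 h2 k j (by omega)
      rw [← add_assoc]
      exact Or.inl ⟨a1.trans hk.le, a3.trans hk.le⟩
    · obtain ⟨j, rfl⟩ : ∃ j, i = 8 * j + 11 := ⟨(i - 11) / 8, by omega⟩
      obtain ⟨⟨-, a2⟩, -, a4⟩ := near_of_digits hα h hs h1 h2 k j (by omega)
      rw [← add_assoc]
      exact Or.inr ⟨a2.trans hk.le, a4.trans hk.le⟩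
  · exact Or.inl rfl

theorem exists_cfDen_le_lt {α : ℝ} (hα : Irrational α) (N : ℕ) {q : ℤ} (hq : cfDen α (N + 1) ≤ q) :
    ∃ n, N ≤ n ∧ cfDen α (n + 1) ≤ q ∧ q < cfDen α (n + 2) := by
  by_contra! hc
  have hall : ∀ k, cfDen α (N + k + 1) ≤ q := by
    intro k
    induction k with
    | zero => exact hq
    | succ k ih => exact hc (N + k) (by omega) ih
  have h1 := hall q.toNat
  have h2 := le_cfDen hα (N + q.toNat + 1)
  push_cast at h2
  omega

theorem le_kConst_of_digits {α : ℝ} (hα : Irrational α) {M : ℕ}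
    (h : ∀ k, cfDigit α (M + k) = if k % 8 = 0 ∨ k % 8 = 5 then 3 else 1)
    {s : ℝ} (hs : s * s = 29237) (h1 : 170.988 < s) (h2 : s < 171) : 164 / s ≤ kConst α := by
  refine le_of_forall_lt fun c hc => ?_
  obtain ⟨c', hcc', hc'⟩ := exists_between hc
  refine hcc'.trans_le ?_
  clear hcc' hc c
  have hs0 : 0 < s := by linarith
  have hc1 : c' < 0.96 := hc'.trans ((div_lt_iff₀ hs0).2 (by linarith))
  rw [lt_div_iff₀ hs0] at hc'
  have hδ : 0 < min 0.001 ((4 - c' * s / 41) / 4) := lt_min (by norm_num) (by linarith)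
  obtain ⟨N, hN⟩ := eventually_near hα h hs (by linarith) h2 hδ
  have hδ1 := min_le_left (0.001 : ℝ) ((4 - c' * s / 41) / 4)
  have hδ2 := min_le_right (0.001 : ℝ) ((4 - c' * s / 41) / 4)
  generalize min (0.001 : ℝ) ((4 - c' * s / 41) / 4) = δ at *
  refine le_kConst hα (cfDen α (N + 1 + 1)).toNat fun p q hq hpq => ?_
  obtain ⟨n, hn, hn1, hn2⟩ := exists_cfDen_le_lt hα (N + 1) (q := q) (by omega)
  have hX0 := denRatio_pos hα n
  have hY0 := cfFront_pos hα n
  have hY1 := cfFront_lt_one hα n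
  have hX1 : denRatio α n < 1 := by
    obtain ⟨i, rfl⟩ : ∃ i, n = i + 1 := ⟨n - 1, by omega⟩
    exact denRatio_succ_lt_one hα i
  rcases val_lower_bound hα hpq hn1 hn2 with hv | hv | ⟨m, hm1, hm2, hv⟩
  · linarith
  · refine le_trans ?_ hv
    rcases hN n (by omega) with e | ⟨e, hne⟩
    · rw [e, le_div_iff₀ (by positivity)]
      push_cast
      nlinarith
    · have hsum : denRatio α n + cfFront α n ≤ (2 * s - 246) / 82 + 2 * δ := by
        rcases hne with ⟨ha, hb⟩ | ⟨ha, hb⟩ <;> rw [abs_le] at ha hb <;> linarith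
      rw [e, le_div_iff₀ (by positivity)]
      push_cast
      rcases le_total c' 0 with hc0 | hc0
      · nlinarith
      · nlinarith
  · rw [hv]
    rcases hN n (by omega) with e | ⟨e, hne⟩
    · rw [e] at hm2
      push_cast at hm2
      have : (m : ℝ) < 1 := by linarith
      have : m < 1 := by exact_mod_cast this
      omega
    · rw [e] at hm2 ⊢
      push_cast at hm2 ⊢
      have : (m : ℝ) < 3 := by linarith
      have : m < 3 := by exact_mod_cast this
      refine hc1.le.trans ?_
      rw [le_div_iff₀ (by positivity)]
      obtain rfl | rfl : m = 1 ∨ m = 2 := by omega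
      all_goals
        push_cast
        rcases hne with ⟨ha, hb⟩ | ⟨ha, hb⟩ <;> rw [abs_le] at ha hb <;> nlinarith

theorem kConst_le_of_digits {α : ℝ} (hα : Irrational α) {M : ℕ}
    (h : ∀ k, cfDigit α (M + k) = if k % 8 = 0 ∨ k % 8 = 5 then 3 else 1)
    {s : ℝ} (hs : s * s = 29237) (h1 : 170.988 < s) (h2 : s < 171) : kConst α ≤ 164 / s := by
  by_contra! hlt
  obtain ⟨c, hc, hck⟩ := exists_between hlt
  have hs0 : 0 < s := by linarith
  have hc0 : 0 < c := lt_trans (by positivity) hc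
  rw [div_lt_iff₀ hs0] at hc
  obtain ⟨K, hK⟩ := le_of_lt_kConst hck
  have hδ : 0 < (c * s / 41 - 4) / (4 * c) := div_pos (by linarith) (by linarith)
  obtain ⟨N, hN⟩ := eventually_near hα h hs (by linarith) h2 hδ
  have hδc : (c * s / 41 - 4) / (4 * c) * c = (c * s / 41 - 4) / 4 := by field_simp
  generalize (c * s / 41 - 4) / (4 * c) = δ at *
  have hX0 := denRatio_pos hα (M + 8 * (N + K.toNat) + 6)
  have hY0 := cfFront_pos hα (M + 8 * (N + K.toNat) + 6)
  have hd : cfDigit α (M + 8 * (N + K.toNat) + 6 + 2) = 3 := by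
    rw [add_assoc, add_assoc, h]
    exact if_pos (Or.inl (by omega))
  have hv := hK _ _ ?_ (notConvergent_two_mul α (M + 8 * (N + K.toNat) + 6 + 1))
  · have hn := hN (M + 8 * (N + K.toNat) + 6) (by omega)
    rw [val_two_mul hα] at hv
    rw [hd] at hv hn
    rw [le_div_iff₀ (by positivity)] at hv
    rcases hn with hn | ⟨-, hn⟩
    · omega
    · have : (2 * s - 246) / 82 - 2 * δ ≤ denRatio α (M + 8 * (N + K.toNat) + 6) +
          cfFront α (M + 8 * (N + K.toNat) + 6) := by
        rcases hn with ⟨ha, hb⟩ | ⟨ha, hb⟩ <;> rw [abs_le] at ha hb <;> linarith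
      push_cast at hv
      nlinarith
  · have := le_cfDen hα (M + 8 * (N + K.toNat) + 6 + 1)
    push_cast at this
    omega

theorem kConst_eq_of_cfEquiv {α : ℝ} (hα : Irrational α)
    (h : CFEquiv α ((13 * √173 + 39) / 82)) : kConst α = 164 / (13 * √173) := by
  obtain ⟨n, m, hn, hm, hnm⟩ := h
  have hd : ∀ k, cfDigit α (n + 3 + 7 * m + k) = if k % 8 = 0 ∨ k % 8 = 5 then 3 else 1 := by
    intro k
    have e := hnm (3 + 7 * m + k) (by omega)
    rw [show m + (3 + 7 * m + k) = 3 + (8 * m + k) by ring, cfDigit_sqrt_oneHundredSeventyThree,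
      Nat.mul_add_mod] at e
    rw [← e]
    congr 1
    omega
  obtain ⟨hs, h1, h2⟩ := thirteen_mul_sqrt_bounds
  have h2' : 13 * √173 < 171 := h2.trans (by norm_num)
  exact le_antisymm (kConst_le_of_digits hα hd hs h1 h2') (le_kConst_of_digits hα hd hs h1 h2')

theorem irrational_sqrt_oneHundredSeventyThree : Irrational ((13 * √173 + 39) / 82) := by
  have h : Irrational √173 := by
    exact_mod_cast (show Nat.Prime 173 by norm_num).irrational_sqrt
  have hsqrt := ((h.ratCast_mul (q := 13) (by norm_num)).add_ratCast 39).div_ratCast (q := 82)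
    (by norm_num)
  push_cast at hsqrt
  exact hsqrt

/-- For `α₀ = (13√173 + 39)/82` and irrational `α` equivalent neither to `(1+√5)/2`
nor to `(1+√17)/2`: `𝔨(α) = 𝔨(α₀) = 164/(13√173)` iff `α ∼ α₀`. -/
theorem stmt_6 (α : ℝ) (hα : Irrational α)
    (h5 : ¬ CFEquiv α ((1 + Real.sqrt 5) / 2))
    (h17 : ¬ CFEquiv α ((1 + Real.sqrt 17) / 2)) :
    (kConst α = kConst ((13 * Real.sqrt 173 + 39) / 82) ∧
      kConst ((13 * Real.sqrt 173 + 39) / 82) = 164 / (13 * Real.sqrt 173)) ↔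
    CFEquiv α ((13 * Real.sqrt 173 + 39) / 82) := by
  have h0 : kConst ((13 * √173 + 39) / 82) = 164 / (13 * √173) :=
    kConst_eq_of_cfEquiv irrational_sqrt_oneHundredSeventyThree
      ⟨1, 1, one_pos, one_pos, fun _ _ => rfl⟩
  constructor
  · rintro ⟨h1, -⟩
    refine cfEquiv_of_lt_kConst hα h5 h17 ?_
    obtain ⟨-, hs0, hs⟩ := thirteen_mul_sqrt_bounds
    rw [h1, h0, lt_div_iff₀ (by linarith)]
    linarith
  · intro h
    exact ⟨(kConst_eq_of_cfEquiv hα h).trans h0.symm, h0⟩
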